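/- Let u : Ω → ℝ be Lipschitz on an open set Ω ⊆ ℝⁿ holding |∇u| ≥ C₂ > 0 a.e. on {r₁ ≤ u ≤ r₂} and H^{n-1}({u = t}) ≤ C₁ for all t ∈ [r₁, r₂]. Then the function h(t) = |{u ≥ t}| (Lebesgue measure of the superlevel set) is Lipschitz on [r₁, r₂] with Lipschitz constant at most C₁/C₂. -/

import Mathlib

open MeasureTheory Set
open scoped NNReal ENNReal

lemma piece_coord {k : ℕ} (G : Set (ℝ × (Fin k → ℝ))) (hG : MeasurableSet G)
    (v : ℝ × (Fin k → ℝ) → ℝ) (hv : ContinuousOn v G) (m : ℝ≥0) (hm : 0 < m)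
    (h : ∀ a b y, (a, y) ∈ G → (b, y) ∈ G → m * |a - b| ≤ |v (a, y) - v (b, y)|) :
    Measurable (fun r => volume {y | ∃ a, (a, y) ∈ G ∧ v (a, y) = r}) ∧
    m * volume G ≤ ∫⁻ r, volume {y | ∃ a, (a, y) ∈ G ∧ v (a, y) = r} := by
  have hm' : (0:ℝ) < m := hm
  have inj : ∀ a b y, (a, y) ∈ G → (b, y) ∈ G → v (a, y) = v (b, y) → a = b := by
    intro a b y ha hb hab
    have := h a b y ha hb
    rw [hab, sub_self, abs_zero] at this
    have h2 : |a - b| ≤ 0 := by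
      by_contra hc
      push Not at hc
      have := mul_pos hm' hc
      linarith
    have := abs_nonpos_iff.1 h2
    linarith
  let Φ : ℝ × (Fin k → ℝ) → ℝ × (Fin k → ℝ) := fun p => (v p, p.2)
  have hΦ : ContinuousOn Φ G := hv.prodMk continuous_snd.continuousOn
  have hinj : InjOn Φ G := by
    rintro ⟨a, y⟩ ha ⟨b, z⟩ hb hab
    simp only [Φ, Prod.mk.injEq] at hab
    obtain ⟨h1, rfl⟩ := hab
    rw [inj a b y ha hb h1]
  have hW : MeasurableSet (Φ '' G) := hG.image_of_continuousOn_injOn hΦ hinj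
  have e1 : ∀ r, Prod.mk r ⁻¹' (Φ '' G) = {y | ∃ a, (a, y) ∈ G ∧ v (a, y) = r} := by
    intro r
    ext y
    simp only [Φ, mem_preimage, mem_image, Prod.mk.injEq, Prod.exists, mem_ofPred_eq]
    constructor
    · rintro ⟨a, z, hz, h1, rfl⟩
      exact ⟨a, hz, h1⟩
    · rintro ⟨a, hz, h1⟩
      exact ⟨a, y, hz, h1, rfl⟩
  have hmeas := measurable_measure_prodMk_left (ν := (volume : Measure (Fin k → ℝ))) hW
  simp only [e1] at hmeas
  refine ⟨hmeas, ?_⟩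
  have e2 : (volume : Measure (ℝ × (Fin k → ℝ))) (Φ '' G)
      = ∫⁻ r, volume {y | ∃ a, (a, y) ∈ G ∧ v (a, y) = r} := by
    rw [Measure.volume_eq_prod, Measure.prod_apply hW]
    simp only [e1]
  rw [← e2, Measure.volume_eq_prod, Measure.prod_apply_symm hW, Measure.prod_apply_symm hG,
    ← lintegral_const_mul' _ _ ENNReal.coe_ne_top]
  refine lintegral_mono fun y => ?_
  set Gy : Set ℝ := (fun a => (a, y)) ⁻¹' G
  have e3 : (fun a => (a, y)) ⁻¹' (Φ '' G) = (fun a => v (a, y)) '' Gy := by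
    ext r
    simp only [Φ, Gy, mem_preimage, mem_image, Prod.mk.injEq, Prod.exists]
    constructor
    · rintro ⟨a, z, hz, h1, rfl⟩
      exact ⟨a, hz, h1⟩
    · rintro ⟨a, hz, h1⟩
      exact ⟨a, y, hz, h1, rfl⟩
  rw [e3]
  have hi : InjOn (fun a => v (a, y)) Gy := fun a ha b hb hab => inj a b y ha hb hab
  let g := Function.invFunOn (fun a => v (a, y)) Gy
  have hg : ∀ a ∈ Gy, g (v (a, y)) = a := fun a ha => hi.leftInvOn_invFunOn ha
  have hgl : LipschitzOnWith m⁻¹ g ((fun a => v (a, y)) '' Gy) := by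
    refine LipschitzOnWith.of_dist_le_mul ?_
    rintro _ ⟨a, ha, rfl⟩ _ ⟨b, hb, rfl⟩
    simp only [hg a ha, hg b hb, Real.dist_eq]
    have := h a b y ha hb
    push_cast
    rw [inv_mul_eq_div, le_div_iff₀ hm']
    linarith
  have e4 : g '' ((fun a => v (a, y)) '' Gy) = Gy := by
    rw [image_image]
    ext a
    constructor
    · rintro ⟨b, hb, rfl⟩
      simpa [hg b hb] using hb
    · intro ha
      exact ⟨a, ha, hg a ha⟩
  have := hgl.hausdorffMeasure_image_le (d := 1) zero_le_one
  rw [e4, hausdorffMeasure_real, ENNReal.rpow_one] at this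
  calc (m : ℝ≥0∞) * volume Gy ≤ m * ((m⁻¹ : ℝ≥0) * volume ((fun a => v (a, y)) '' Gy)) := by gcongr
    _ = volume ((fun a => v (a, y)) '' Gy) := by
      rw [← mul_assoc, ← ENNReal.coe_mul, mul_inv_cancel₀ hm.ne', ENNReal.coe_one, one_mul]

lemma piece_space {k : ℕ} (S : Set (EuclideanSpace ℝ (Fin (k + 1)))) (hS : MeasurableSet S)
    (u : EuclideanSpace ℝ (Fin (k + 1)) → ℝ) (hu : ContinuousOn u S)
    (A : EuclideanSpace ℝ (Fin (k + 1)) →L[ℝ] ℝ) (c m : ℝ≥0) (hm : 0 < m)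
    (hcm : (c : ℝ) + m ≤ ‖A‖) (hA : ApproximatesLinearOn u A S c) :
    ∃ f : ℝ → ℝ≥0∞, Measurable f ∧
      (∀ r, f r ≤ μH[((k + 1 : ℕ) : ℝ) - 1] (S ∩ u ⁻¹' {r})) ∧
      m * volume S ≤ ∫⁻ r, f r := by
  have hm' : (0:ℝ) < m := hm
  have hApos : 0 < ‖A‖ := by have := c.2; change (0:ℝ) ≤ c at this; linarith
  set w := (InnerProductSpace.toDual ℝ (EuclideanSpace ℝ (Fin (k + 1)))).symm A with hw
  have hwn : ‖w‖ = ‖A‖ := LinearIsometryEquiv.norm_map _ _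
  set e := ‖w‖⁻¹ • w with he
  have hen : ‖e‖ = 1 := by
    rw [he, norm_smul, norm_inv, norm_norm, inv_mul_cancel₀]
    rw [hwn]; exact hApos.ne'
  have hAe : A e = ‖A‖ := by
    rw [← InnerProductSpace.toDual_symm_apply, ← hw, he, inner_smul_right,
      real_inner_self_eq_norm_sq, hwn]
    field_simp
  obtain ⟨b, hb⟩ := Orthonormal.exists_orthonormalBasis_extension_of_card_eq (𝕜 := ℝ)
    (E := EuclideanSpace ℝ (Fin (k + 1))) (ι := Fin (k + 1)) (by simp)
    (v := fun _ => e) (s := {0}) (by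
      constructor
      · intro i; simpa using hen
      · intro i j hij; exact absurd (Subsingleton.elim i j) hij)
  have hb0 : b 0 = e := hb 0 rfl
  let Q : ℝ × (Fin k → ℝ) → EuclideanSpace ℝ (Fin (k + 1)) :=
    fun p => b.repr.symm (WithLp.toLp 2 ((MeasurableEquiv.piFinSuccAbove (fun _ => ℝ) 0).symm p))
  have hQ : MeasurePreserving Q volume volume :=
    b.measurePreserving_repr_symm.comp ((PiLp.volume_preserving_toLp _).comp
      (volume_preserving_piFinSuccAbove (fun _ => ℝ) 0).symm)
  have hQ0 : ∀ p, b.repr (Q p) 0 = p.1 := by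
    intro p
    simp [Q, MeasurableEquiv.piFinSuccAbove]
  have hQs : ∀ p j, b.repr (Q p) (Fin.succ j) = p.2 j := by
    intro p j
    simp [Q, MeasurableEquiv.piFinSuccAbove]
  have hQc : Continuous Q := by
    refine b.repr.symm.continuous.comp ((PiLp.continuous_toLp 2 _).comp ?_)
    refine continuous_pi fun j => ?_
    refine Fin.cases ?_ (fun j => ?_) j
    · simpa [MeasurableEquiv.piFinSuccAbove] using continuous_fst
    · simp only [MeasurableEquiv.piFinSuccAbove, MeasurableEquiv.symm_mk, MeasurableEquiv.coe_mk]
      exact (continuous_apply j).comp continuous_snd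
  have hQd : ∀ a a' y, Q (a, y) - Q (a', y) = (a - a') • e := by
    intro a a' y
    apply b.repr.injective
    ext j
    rw [← hb0]
    refine Fin.cases ?_ (fun j => ?_) j
    · simp [hQ0]
    · simp [hQs]
  obtain ⟨h1, h2⟩ := piece_coord (Q ⁻¹' S) (hQ.measurable hS) (u ∘ Q)
    (hu.comp hQc.continuousOn (fun _ h => h)) m hm (by
      intro a a' y ha ha'
      have := hA _ ha _ ha'
      rw [hQd, map_smul, hAe, norm_smul, hen, Real.norm_eq_abs, Real.norm_eq_abs, smul_eq_mul] at this
      simp only [Function.comp]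
      have h3 : |(a - a') * ‖A‖| = |a - a'| * ‖A‖ := by rw [abs_mul, abs_norm]
      have h4 := abs_sub_abs_le_abs_sub ((a - a') * ‖A‖) (u (Q (a, y)) - u (Q (a', y)))
      rw [abs_sub_comm ((a - a') * ‖A‖)] at h4
      have h5 := mul_le_mul_of_nonneg_left hcm (abs_nonneg (a - a'))
      nlinarith)
  refine ⟨_, h1, ?_, ?_⟩
  · intro r
    let P : EuclideanSpace ℝ (Fin (k + 1)) → (Fin k → ℝ) := fun x j => b.repr x (Fin.succ j)
    have hP : LipschitzWith 1 P := by
      refine LipschitzWith.of_dist_le_mul fun x y => ?_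
      rw [NNReal.coe_one, one_mul, dist_pi_le_iff dist_nonneg]
      intro j
      rw [← b.repr.dist_map x y, dist_eq_norm (b.repr x), Real.dist_eq]
      exact PiLp.norm_apply_le (b.repr x - b.repr y) (Fin.succ j)
    have h3 := (hP.lipschitzOnWith (s := S ∩ u ⁻¹' {r})).hausdorffMeasure_image_le
      (d := (k : ℝ)) (Nat.cast_nonneg k)
    have h4 : ((k + 1 : ℕ) : ℝ) - 1 = k := by push_cast; ring
    rw [h4]
    have h5 : (μH[(k:ℝ)] : Measure (Fin k → ℝ)) = volume := by
      simpa using hausdorffMeasure_pi_real (ι := Fin k)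
    rw [h5, ENNReal.coe_one, ENNReal.one_rpow, one_mul] at h3
    refine le_trans (measure_mono ?_) h3
    rintro y ⟨a, ha, hr⟩
    exact ⟨Q (a, y), ⟨ha, hr⟩, funext fun j => hQs _ _⟩
  · rwa [hQ.measure_preimage hS.nullMeasurableSet] at h2

lemma slab {n : ℕ} (Ω : Set (EuclideanSpace ℝ (Fin n))) (hΩ : IsOpen Ω)
    (u : EuclideanSpace ℝ (Fin n) → ℝ) (L : ℝ≥0) (hu : LipschitzOnWith L u Ω)
    (C₁ C₂ : ℝ) (hC₂ : 0 < C₂) (t s : ℝ)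
    (hgrad : ∀ᵐ x ∂(volume : Measure (EuclideanSpace ℝ (Fin n))),
      x ∈ Ω → t ≤ u x → u x ≤ s → C₂ ≤ ‖fderiv ℝ u x‖)
    (harea : ∀ r ∈ Set.Icc t s,
      μH[(n:ℝ) - 1] {x | x ∈ Ω ∧ u x = r} ≤ ENNReal.ofReal C₁)
    (m : ℝ≥0) (hm : 0 < m) (hmC : (m : ℝ) < C₂) :
    m * volume {x | x ∈ Ω ∧ t ≤ u x ∧ u x < s} ≤ ENNReal.ofReal C₁ * ENNReal.ofReal (s - t) := by
  obtain ⟨g, hg, hgu⟩ := hu.extend_real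
  set D : Set (EuclideanSpace ℝ (Fin n)) :=
    ((Ω ∩ g ⁻¹' (Ico t s)) ∩ {x | DifferentiableAt ℝ u x}) ∩ {x | C₂ ≤ ‖fderiv ℝ u x‖} with hD
  have hDm : MeasurableSet D :=
    ((hΩ.measurableSet.inter (hg.continuous.measurable measurableSet_Ico)).inter
      (measurableSet_of_differentiableAt ℝ u)).inter
      (measurableSet_le measurable_const (measurable_fderiv ℝ u).norm)
  have hDΩ : D ⊆ Ω := fun x hx => hx.1.1.1
  have hDu : ∀ x ∈ D, t ≤ u x ∧ u x < s := by
    intro x hx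
    rw [hgu (hDΩ hx)]
    exact hx.1.1.2
  have hvol : volume {x | x ∈ Ω ∧ t ≤ u x ∧ u x < s} ≤ volume D := by
    apply measure_mono_ae
    filter_upwards [hgrad, hg.ae_differentiableAt (μ := volume)] with x h1 h2
    rintro ⟨hx, hx1, hx2⟩
    refine ⟨⟨⟨hx, ?_⟩, ?_⟩, h1 hx hx1 hx2.le⟩
    · rw [mem_preimage, ← hgu hx]; exact ⟨hx1, hx2⟩
    · exact h2.congr_of_eventuallyEq (hgu.eventuallyEq_of_mem (hΩ.mem_nhds hx))
  refine le_trans (mul_le_mul_right hvol _) ?_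
  rcases D.eq_empty_or_nonempty with h0 | hne
  · simp [h0]
  cases n with
  | zero =>
    exfalso
    obtain ⟨x, hx⟩ := hne
    have h1 : C₂ ≤ ‖fderiv ℝ u x‖ := hx.2
    rw [Subsingleton.elim (fderiv ℝ u x) 0, norm_zero] at h1
    linarith
  | succ k =>
  set c : ℝ≥0 := Real.toNNReal (C₂ - m) with hc
  have hc' : (c : ℝ) = C₂ - m := Real.coe_toNNReal _ (by linarith)
  obtain ⟨T, A, hdisj, hTm, hcov, happ, hAy⟩ :=
    exists_partition_approximatesLinearOn_of_hasFDerivWithinAt u D (fderiv ℝ u)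
      (fun x hx => (hx.1.2 : DifferentiableAt ℝ u x).hasFDerivAt.hasFDerivWithinAt)
      (fun _ => c) (fun _ => by
        intro h; rw [h] at hc'; simp at hc'; linarith)
  have key : ∀ i, ∃ f : ℝ → ℝ≥0∞, Measurable f ∧
      (∀ r, f r ≤ μH[((k + 1 : ℕ) : ℝ) - 1] ((D ∩ T i) ∩ u ⁻¹' {r})) ∧
      m * volume (D ∩ T i) ≤ ∫⁻ r, f r := by
    intro i
    refine piece_space (D ∩ T i) (hDm.inter (hTm i)) u
      (hu.continuousOn.mono (inter_subset_left.trans hDΩ)) (A i) c m hm ?_ (happ i)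
    obtain ⟨y, hy, hAi⟩ := hAy hne i
    rw [hAi, hc']
    have : C₂ ≤ ‖fderiv ℝ u y‖ := hy.2
    linarith
  choose f hfm hfH hfi using key
  have hdis' : Pairwise (Function.onFun Disjoint fun i => D ∩ T i) := fun i j hij =>
    (hdisj hij).mono inter_subset_right inter_subset_right
  have hDeq : D = ⋃ i, D ∩ T i := by
    rw [← inter_iUnion]; exact (inter_eq_left.2 hcov).symm
  have hpt : ∀ r, ∑' i, f i r ≤ (Icc t s).indicator (fun _ => ENNReal.ofReal C₁) r := by
    intro r
    have hlm : MeasurableSet (D ∩ u ⁻¹' {r}) := by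
      have : D ∩ u ⁻¹' {r} = D ∩ g ⁻¹' {r} := by
        ext x
        constructor
        · rintro ⟨hx, hx'⟩
          exact ⟨hx, by rw [mem_preimage, ← hgu (hDΩ hx)]; exact hx'⟩
        · rintro ⟨hx, hx'⟩
          exact ⟨hx, by rw [mem_preimage, hgu (hDΩ hx)]; exact hx'⟩
      rw [this]
      exact hDm.inter (hg.continuous.measurable (measurableSet_singleton r))
    have h1 : ∑' i, f i r ≤ μH[((k + 1 : ℕ) : ℝ) - 1] (D ∩ u ⁻¹' {r}) := by
      calc ∑' i, f i r ≤ ∑' i, μH[((k + 1 : ℕ) : ℝ) - 1] ((D ∩ T i) ∩ u ⁻¹' {r}) :=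
            ENNReal.tsum_le_tsum fun i => hfH i r
        _ = μH[((k + 1 : ℕ) : ℝ) - 1] (⋃ i, (D ∩ T i) ∩ u ⁻¹' {r}) := by
            rw [measure_iUnion]
            · exact fun i j hij => (hdis' hij).mono inter_subset_left inter_subset_left
            · intro i
              have : (D ∩ T i) ∩ u ⁻¹' {r} = (D ∩ u ⁻¹' {r}) ∩ T i := by
                rw [inter_right_comm]
              rw [this]
              exact hlm.inter (hTm i)
        _ = _ := by rw [← iUnion_inter, ← hDeq]
    refine h1.trans ?_
    by_cases hr : r ∈ Icc t s
    · rw [indicator_of_mem hr]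
      refine le_trans (measure_mono ?_) (harea r hr)
      intro x hx
      exact ⟨hDΩ hx.1, hx.2⟩
    · have : D ∩ u ⁻¹' {r} = ∅ := by
        ext x
        simp only [mem_inter_iff, mem_preimage, mem_singleton_iff, mem_empty_iff_false, iff_false]
        rintro ⟨hx, rfl⟩
        exact hr ⟨(hDu x hx).1, (hDu x hx).2.le⟩
      simp [this]
  calc (m : ℝ≥0∞) * volume D = ∑' i, m * volume (D ∩ T i) := by
        conv_lhs => rw [hDeq]
        rw [measure_iUnion hdis' (fun i => hDm.inter (hTm i)), ENNReal.tsum_mul_left]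
    _ ≤ ∑' i, ∫⁻ r, f i r := ENNReal.tsum_le_tsum hfi
    _ = ∫⁻ r, ∑' i, f i r := (lintegral_tsum fun i => (hfm i).aemeasurable).symm
    _ ≤ ∫⁻ r, (Icc t s).indicator (fun _ => ENNReal.ofReal C₁) r := lintegral_mono hpt
    _ = _ := by
        rw [lintegral_indicator measurableSet_Icc, setLIntegral_const, Real.volume_Icc]

/-- Coarea/Lipschitz bound: if `u` is Lipschitz on a bounded open set `Ω`, `|∇u| ≥ C₂`
a.e. on `{r₁ ≤ u ≤ r₂}` and `H^{n-1}({u = t}) ≤ C₁` for `t ∈ [r₁, r₂]`, then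
`t ↦ |{u ≥ t}|` is Lipschitz on `[r₁, r₂]` with constant `C₁/C₂`. -/
theorem stmt11 (n : ℕ) (Ω : Set (EuclideanSpace ℝ (Fin n))) (hΩ : IsOpen Ω)
    (hΩbd : Bornology.IsBounded Ω)
    (u : EuclideanSpace ℝ (Fin n) → ℝ) (L : ℝ≥0) (hu : LipschitzOnWith L u Ω)
    (r₁ r₂ C₁ C₂ : ℝ) (hr : r₁ < r₂) (hC₁ : 0 < C₁) (hC₂ : 0 < C₂)
    (hgrad : ∀ᵐ x ∂(volume : Measure (EuclideanSpace ℝ (Fin n))),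
      x ∈ Ω → r₁ ≤ u x → u x ≤ r₂ → C₂ ≤ ‖fderiv ℝ u x‖)
    (harea : ∀ t ∈ Set.Icc r₁ r₂,
      μH[(n:ℝ) - 1] {x | x ∈ Ω ∧ u x = t} ≤ ENNReal.ofReal C₁) :
    LipschitzOnWith (Real.toNNReal (C₁ / C₂))
      (fun t => (volume {x | x ∈ Ω ∧ t ≤ u x}).toReal) (Set.Icc r₁ r₂) := by
  have hfin : ∀ V ⊆ Ω, volume V ≠ ∞ := fun V hV =>
    ((measure_mono hV).trans_lt hΩbd.measure_lt_top).ne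
  have main : ∀ t ∈ Icc r₁ r₂, ∀ s ∈ Icc r₁ r₂, t ≤ s →
      |(volume {x | x ∈ Ω ∧ t ≤ u x}).toReal - (volume {x | x ∈ Ω ∧ s ≤ u x}).toReal|
        ≤ C₁ / C₂ * (s - t) := by
    intro t ht s hs hts
    set S := {x | x ∈ Ω ∧ t ≤ u x ∧ u x < s} with hS
    have hmono : (volume {x | x ∈ Ω ∧ s ≤ u x}).toReal ≤ (volume {x | x ∈ Ω ∧ t ≤ u x}).toReal :=
      ENNReal.toReal_mono (hfin _ fun x hx => hx.1)
        (measure_mono fun x hx => ⟨hx.1, hts.trans hx.2⟩)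
    have hsub : (volume {x | x ∈ Ω ∧ t ≤ u x}).toReal
        ≤ (volume {x | x ∈ Ω ∧ s ≤ u x}).toReal + (volume S).toReal := by
      rw [← ENNReal.toReal_add (hfin _ fun x hx => hx.1) (hfin _ fun x hx => hx.1)]
      refine ENNReal.toReal_mono (ENNReal.add_ne_top.2
        ⟨hfin _ fun x hx => hx.1, hfin _ fun x hx => hx.1⟩) ?_
      refine le_trans (measure_mono ?_) (measure_union_le _ _)
      intro x hx
      rcases le_or_gt s (u x) with h | h
      · exact Or.inl ⟨hx.1, h⟩
      · exact Or.inr ⟨hx.1, hx.2, h⟩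
    have hm : ∀ m ∈ Ioo 0 C₂, m * (volume S).toReal ≤ C₁ * (s - t) := by
      intro m hm
      have h1 := slab Ω hΩ u L hu C₁ C₂ hC₂ t s
        (by filter_upwards [hgrad] with x hx h1 h2 h3
            exact hx h1 (ht.1.trans h2) (h3.trans hs.2))
        (fun r hr => harea r ⟨ht.1.trans hr.1, hr.2.trans hs.2⟩) m.toNNReal
        (Real.toNNReal_pos.2 hm.1) (by rw [Real.coe_toNNReal _ hm.1.le]; exact hm.2)
      have h2 := ENNReal.toReal_mono (ENNReal.mul_ne_top ENNReal.ofReal_ne_top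
        ENNReal.ofReal_ne_top) h1
      rwa [ENNReal.toReal_mul, ENNReal.toReal_mul, ENNReal.toReal_ofReal hC₁.le,
        ENNReal.toReal_ofReal (by linarith), ENNReal.coe_toReal,
        Real.coe_toNNReal _ hm.1.le] at h2
    have hlim : C₂ * (volume S).toReal ≤ C₁ * (s - t) := by
      have hcl : C₂ ∈ closure (Ioo 0 C₂) := by
        rw [closure_Ioo hC₂.ne]; exact ⟨hC₂.le, le_rfl⟩
      exact closure_minimal (s := Ioo 0 C₂) (t := {m | m * (volume S).toReal ≤ C₁ * (s - t)}) hm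
        (isClosed_le (by fun_prop) continuous_const) hcl
    have : (volume S).toReal ≤ C₁ / C₂ * (s - t) := by
      rw [div_mul_eq_mul_div, le_div_iff₀ hC₂]
      linarith
    rw [abs_of_nonneg (by linarith)]
    linarith
  refine LipschitzOnWith.of_dist_le_mul ?_
  intro t ht s hs
  rw [Real.coe_toNNReal _ (by positivity), Real.dist_eq, Real.dist_eq]
  rcases le_total t s with h | h
  · rw [abs_sub_comm t s, abs_of_nonneg (by linarith : 0 ≤ s - t)]
    exact main t ht s hs h
  · rw [abs_of_nonneg (by linarith : 0 ≤ t - s), abs_sub_comm]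
    exact main s hs t ht h
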